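/- Let (c_d)_{d≥0} be a sequence of complex numbers with c_d ≠ 0 for all sufficiently large d, suppose lim_{d→∞} c_d / c_{d+1} = z exists with z ≠ 0, and let f : B(0,|z|) → ℂ be the sum f(t) = Σ_{d≥0} c_d t^d on the open disk B(0,|z|) = { t ∈ ℂ : |t| < |z| }. Then z is a singular point of the series: there is no open set U ⊆ ℂ containing z together with a function g that is analytic at every point of B(0,|z|) ∪ U and agrees with f on B(0,|z|). -/

import Mathlib

open Filter

section Parseval

open MeasureTheory AddCircle

/-- Parseval's identity for an absolutely convergent series. -/
theorem hasSum_sq_norm_integral_fourier {u : ℕ → ℂ} (hu : Summable fun d => ‖u d‖) :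
    HasSum (fun d => ‖u d‖ ^ 2)
      (∫ x : UnitAddCircle, ‖∑' d, u d * (fourier 1 x) ^ d‖ ^ 2 ∂haarAddCircle) := by
  have hsum : Summable fun d : ℕ => u d • (fourier (d : ℤ) : C(UnitAddCircle, ℂ)) := by
    apply Summable.of_norm
    simpa [norm_smul, fourier_norm] using hu
  obtain ⟨F, hF⟩ := hsum
  have hFx (x : UnitAddCircle) : ∑' d, u d * (fourier 1 x) ^ d = F x := by
    have h := (ContinuousMap.hasSum_apply hF x).tsum_eq
    rw [← h]
    refine tsum_congr fun d => ?_
    simp [fourier_apply, AddCircle.toCircle_nsmul]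
  simp_rw [hFx]
  have hL : HasSum (fun d : ℕ => u d • fourierLp 2 (d : ℤ))
      (ContinuousMap.toLp (E := ℂ) 2 haarAddCircle ℂ F) := by
    have := hF.mapL (ContinuousMap.toLp (E := ℂ) 2 (haarAddCircle (T := 1)) ℂ)
    simpa [fourierLp] using this
  have hv : Orthonormal ℂ (fun d : ℕ => fourierLp (T := 1) 2 (d : ℤ)) :=
    orthonormal_fourier.comp _ Nat.cast_injective
  have hn := (Filter.Tendsto.norm hL).pow 2
  have h2 : ‖ContinuousMap.toLp (E := ℂ) 2 haarAddCircle ℂ F‖ ^ 2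
      = ∫ x : UnitAddCircle, ‖F x‖ ^ 2 ∂haarAddCircle := by
    have h := ContinuousMap.inner_toLp (𝕜 := ℂ) haarAddCircle F F
    rw [inner_self_eq_norm_sq_to_K] at h
    simp_rw [RCLike.mul_conj] at h
    have h' : ((‖ContinuousMap.toLp (E := ℂ) 2 haarAddCircle ℂ F‖ ^ 2 : ℝ) : ℂ)
      = ((∫ x : UnitAddCircle, ‖F x‖ ^ 2 ∂haarAddCircle : ℝ) : ℂ) := by
      rw [← integral_complex_ofReal]
      simpa using h
    exact_mod_cast h'
  rw [← h2]
  refine hn.congr fun s => ?_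
  have h := hv.inner_sum u u s
  rw [inner_self_eq_norm_sq_to_K] at h
  simp_rw [RCLike.conj_mul] at h
  exact_mod_cast h

/-- A power series that is small on the arc `‖1 - t‖ < m` of the unit circle has coefficients whose
consecutive differences are large in `ℓ²`. -/
theorem sq_mul_tsum_sub_le_tsum_sq_norm_diff {u : ℕ → ℂ} (hu : Summable fun d => ‖u d‖)
    (hu0 : u 0 = 0) {m E : ℝ} (hm : 0 ≤ m)
    (hE : ∀ t : ℂ, ‖t‖ = 1 → ‖1 - t‖ < m → ‖∑' d, u d * t ^ d‖ ^ 2 ≤ E) (hE0 : 0 ≤ E) :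
    m ^ 2 * (∑' d, ‖u d‖ ^ 2 - E) ≤ ∑' d, ‖u (d + 1) - u d‖ ^ 2 := by
  have hu' : Summable fun d => ‖u (d + 1)‖ := (summable_nat_add_iff 1).2 hu
  have hv : Summable fun d => ‖u (d + 1) - u d‖ :=
    .of_nonneg_of_le (fun _ => norm_nonneg _) (fun d => norm_sub_le _ _) (hu'.add hu)
  have hnorm (x : UnitAddCircle) : ‖fourier 1 x‖ = 1 := by
    rw [fourier_apply]; exact Circle.norm_coe _
  have hcont {w : ℕ → ℂ} (hw : Summable fun d => ‖w d‖) :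
      Integrable (fun x : UnitAddCircle => ‖∑' d, w d * (fourier 1 x) ^ d‖ ^ 2)
        haarAddCircle := by
    have : Continuous (fun x : UnitAddCircle => ‖∑' d, w d * (fourier 1 x) ^ d‖ ^ 2) := by
      refine (Continuous.norm ?_).pow 2
      exact continuous_tsum (fun d => by fun_prop) hw
        (fun d x => by rw [norm_mul, norm_pow, hnorm, one_pow, mul_one])
    exact (ContinuousMap.mk _ this).continuous.integrable_of_hasCompactSupport
      (HasCompactSupport.of_compactSpace _)
  rw [(hasSum_sq_norm_integral_fourier hu).tsum_eq, (hasSum_sq_norm_integral_fourier hv).tsum_eq]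
  have hI : m ^ 2 * (∫ x : UnitAddCircle, ‖∑' d, u d * (fourier 1 x) ^ d‖ ^ 2 ∂haarAddCircle - E)
      = ∫ x : UnitAddCircle, m ^ 2 * (‖∑' d, u d * (fourier 1 x) ^ d‖ ^ 2 - E)
        ∂haarAddCircle := by
    rw [integral_const_mul, integral_sub (hcont hu) (integrable_const _)]
    simp
  rw [hI]
  refine integral_mono (((hcont hu).sub (integrable_const _)).const_mul _) (hcont hv) fun x => ?_
  set t := fourier 1 x
  have ht : ‖t‖ = 1 := hnorm x
  have hs {w : ℕ → ℂ} (hw : Summable fun d => ‖w d‖) : Summable fun d => w d * t ^ d :=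
    .of_norm (by simpa [ht] using hw)
  have key : t * ∑' d, (u (d + 1) - u d) * t ^ d = (1 - t) * ∑' d, u d * t ^ d := by
    have h1 : ∑' d, u d * t ^ d = t * ∑' d, u (d + 1) * t ^ d := by
      rw [(hs hu).tsum_eq_zero_add, hu0, ← tsum_mul_left]
      simp only [zero_mul, zero_add]
      exact tsum_congr fun d => by ring
    simp_rw [sub_mul]
    rw [(hs hu').tsum_sub (hs hu), mul_sub, ← h1, one_mul]
  have key' : ‖∑' d, (u (d + 1) - u d) * t ^ d‖ = ‖1 - t‖ * ‖∑' d, u d * t ^ d‖ := by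
    rw [← norm_mul, ← key, norm_mul, ht, one_mul]
  change m ^ 2 * (‖∑' d, u d * t ^ d‖ ^ 2 - E) ≤ ‖∑' d, (u (d + 1) - u d) * t ^ d‖ ^ 2
  rw [key', mul_pow]
  rcases lt_or_ge ‖1 - t‖ m with h | h
  · have := hE t ht h
    exact (mul_nonpos_of_nonneg_of_nonpos (sq_nonneg m) (by linarith)).trans (by positivity)
  · have : m ^ 2 ≤ ‖1 - t‖ ^ 2 := by gcongr
    nlinarith [sq_nonneg ‖∑' d, u d * t ^ d‖, mul_nonneg (sq_nonneg m) hE0]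

end Parseval

theorem tsum_sq_norm_diff_le {u : ℕ → ℂ} (hu : Summable fun d => ‖u d‖ ^ 2) {ε η : ℝ} {K : ℕ}
    (h : ∀ d, ‖u (d + 1) - u d‖ ≤ ε * ‖u d‖ ∨ ‖u (d + 1) - u d‖ ≤ η * ‖u (d + 1 + K)‖ ∨
      K ≤ d ∧ ‖u (d + 1) - u d‖ ≤ η * ‖u (d - K)‖) :
    ∑' d, ‖u (d + 1) - u d‖ ^ 2 ≤ (ε ^ 2 + 2 * η ^ 2) * ∑' d, ‖u d‖ ^ 2 := by
  set b : ℕ → ℝ := fun d => if K ≤ d then ‖u (d - K)‖ ^ 2 else 0 with hb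
  have hbs : HasSum b (∑' d, ‖u d‖ ^ 2) := by
    have h0 : HasSum (fun d => b (d + K)) (∑' d, ‖u d‖ ^ 2) := by simpa [hb] using hu.hasSum
    have := (hasSum_nat_add_iff K).1 h0
    rwa [Finset.sum_eq_zero, add_zero] at this
    intro i hi
    simp [hb, Finset.mem_range.1 hi]
  have hbn (d) : 0 ≤ b d := by simp only [hb]; split_ifs <;> positivity
  have hsh : Summable fun d => ‖u (d + 1 + K)‖ ^ 2 := by
    simpa [add_assoc] using (summable_nat_add_iff (1 + K)).2 hu
  have hshle : ∑' d, ‖u (d + 1 + K)‖ ^ 2 ≤ ∑' d, ‖u d‖ ^ 2 := by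
    have := hu.sum_add_tsum_nat_add (1 + K)
    simp only [← add_assoc] at this
    rw [← this]
    exact le_add_of_nonneg_left (Finset.sum_nonneg fun _ _ => sq_nonneg _)
  have hS := ((hu.mul_left (ε ^ 2)).add (hsh.mul_left (η ^ 2))).add (hbs.summable.mul_left (η ^ 2))
  have hle (d) : ‖u (d + 1) - u d‖ ^ 2 ≤
      ε ^ 2 * ‖u d‖ ^ 2 + η ^ 2 * ‖u (d + 1 + K)‖ ^ 2 + η ^ 2 * b d := by
    have h1 : 0 ≤ ε ^ 2 * ‖u d‖ ^ 2 := by positivity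
    have h2 : 0 ≤ η ^ 2 * ‖u (d + 1 + K)‖ ^ 2 := by positivity
    have h3 : 0 ≤ η ^ 2 * b d := mul_nonneg (sq_nonneg _) (hbn d)
    rcases h d with h | h | ⟨hK, h⟩
    · have := pow_le_pow_left₀ (norm_nonneg _) h 2
      rw [mul_pow] at this; linarith
    · have := pow_le_pow_left₀ (norm_nonneg _) h 2
      rw [mul_pow] at this; linarith
    · have := pow_le_pow_left₀ (norm_nonneg _) h 2
      have hbd : b d = ‖u (d - K)‖ ^ 2 := by simp [hb, hK]
      rw [mul_pow, ← hbd] at this; linarith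
  have := Summable.tsum_le_tsum hle (.of_nonneg_of_le (fun _ => sq_nonneg _) hle hS) hS
  rw [Summable.tsum_add ((hu.mul_left _).add (hsh.mul_left _)) (hbs.summable.mul_left _),
    Summable.tsum_add (hu.mul_left _) (hsh.mul_left _), tsum_mul_left, tsum_mul_left,
    tsum_mul_left, hbs.tsum_eq] at this
  nlinarith [mul_le_mul_of_nonneg_left hshle (sq_nonneg η)]

theorem summable_norm_mul_pow_of_ratio {c : ℕ → ℂ} (hc : ∀ᶠ d in atTop, c d ≠ 0)
    (hr : Tendsto (fun d => c (d + 1) / c d) atTop (nhds 1)) {r : ℝ} (hr0 : 0 < r) (hr1 : r < 1) :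
    Summable fun d => ‖c d‖ * r ^ d := by
  refine summable_of_ratio_test_tendsto_lt_one hr1 (hc.mono fun d hd => by positivity) ?_
  have := hr.norm.mul_const r
  rw [norm_one, one_mul] at this
  refine this.congr' (hc.mono fun d hd => ?_)
  have : ‖c d‖ ≠ 0 := norm_ne_zero_iff.2 hd
  beta_reduce
  rw [norm_mul, norm_mul, norm_norm, norm_norm, norm_pow, norm_pow, Real.norm_of_nonneg hr0.le,
    norm_div, pow_succ]
  field_simp

theorem tendsto_ratio_derivative_coeff {c : ℕ → ℂ}
    (hr : Tendsto (fun d => c (d + 1) / c d) atTop (nhds 1)) :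
    Tendsto (fun d : ℕ => (((d + 1 : ℕ) + 1 : ℂ) * c (d + 1 + 1)) / ((d + 1) * c (d + 1)))
      atTop (nhds 1) := by
  have h1 : Tendsto (fun d : ℕ => 1 + 1 / ((d : ℂ) + 1)) atTop (nhds (1 + 0)) :=
    tendsto_const_nhds.add (tendsto_one_div_add_atTop_nhds_zero_nat (𝕜 := ℂ))
  have h2 := h1.mul (hr.comp (tendsto_add_atTop_nat 1))
  rw [add_zero, one_mul] at h2
  refine h2.congr fun d => ?_
  have : (d : ℂ) + 1 ≠ 0 := Nat.cast_add_one_ne_zero d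
  simp only [Function.comp]
  rw [mul_div_mul_comm]
  congr 1
  push_cast
  field_simp

theorem deriv_eq_tsum_of_ratio {c : ℕ → ℂ} (hc : ∀ᶠ d in atTop, c d ≠ 0)
    (hr : Tendsto (fun d => c (d + 1) / c d) atTop (nhds 1)) {g : ℂ → ℂ}
    (hg : ∀ t ∈ Metric.ball (0 : ℂ) 1, g t = ∑' d, c d * t ^ d) {t : ℂ}
    (ht : t ∈ Metric.ball (0 : ℂ) 1) : deriv g t = ∑' d : ℕ, ((d + 1) * c (d + 1)) * t ^ d := by
  rw [mem_ball_zero_iff] at ht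
  obtain ⟨r, htr, hr1⟩ := exists_between ht
  have hr0 : 0 < r := (norm_nonneg t).trans_lt htr
  have hsum := Complex.hasSum_deriv_of_summable_norm (U := Metric.ball 0 r) (z := t)
    (F := fun d w => c d * w ^ d) (summable_norm_mul_pow_of_ratio hc hr hr0 hr1)
    (fun d => by fun_prop) Metric.isOpen_ball
    (fun d w hw => by
      rw [norm_mul, norm_pow]
      gcongr
      exact (mem_ball_zero_iff.1 hw).le) (mem_ball_zero_iff.2 htr)
  have hev : g =ᶠ[nhds t] fun w => ∑' d, c d * w ^ d :=
    Filter.eventually_of_mem (Metric.isOpen_ball.mem_nhds (mem_ball_zero_iff.2 ht)) hg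
  rw [hev.deriv_eq, ← hsum.tsum_eq, hsum.summable.tsum_eq_zero_add]
  simp only [pow_zero, mul_one, deriv_const, zero_add]
  refine tsum_congr fun d => ?_
  rw [deriv_const_mul _ (by fun_prop), deriv_pow_field]
  rw [Nat.add_sub_cancel]
  push_cast
  ring

theorem iteratedDeriv_eq_tsum_of_ratio (n : ℕ) {c : ℕ → ℂ} (hc : ∀ᶠ d in atTop, c d ≠ 0)
    (hr : Tendsto (fun d => c (d + 1) / c d) atTop (nhds 1)) {g : ℂ → ℂ}
    (hg : ∀ t ∈ Metric.ball (0 : ℂ) 1, g t = ∑' d, c d * t ^ d) {t : ℂ}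
    (ht : t ∈ Metric.ball (0 : ℂ) 1) :
    iteratedDeriv n g t = ∑' d : ℕ, n.factorial * ((d + n).choose n * c (d + n)) * t ^ d := by
  induction n generalizing c g with
  | zero => simpa using hg t ht
  | succ n ih =>
    rw [iteratedDeriv_succ']
    rw [ih (c := fun d => (d + 1) * c (d + 1)) ?_ ?_
      fun t ht => deriv_eq_tsum_of_ratio hc hr hg ht]
    · refine tsum_congr fun d => ?_
      have h : ((d + n + 1 : ℕ) : ℂ) * (d + n).choose n =
          (d + n + 1).choose (n + 1) * (n + 1 : ℕ) := by
        exact_mod_cast Nat.add_one_mul_choose_eq (d + n) n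
      rw [Nat.factorial_succ, ← add_assoc]
      push_cast at h ⊢
      linear_combination (n.factorial * c (d + n + 1) * t ^ d : ℂ) * h
    · filter_upwards [(tendsto_add_atTop_nat 1).eventually hc] with d hd
      exact mul_ne_zero (Nat.cast_add_one_ne_zero d) hd
    · exact tendsto_ratio_derivative_coeff hr

/-- The `d`-th term of the series computing `2⁻ⁿ` times the `n`-th Taylor coefficient of
`∑ c_d t^d` at `1 / 2`. -/
noncomputable def halfBinomialTerm (c : ℕ → ℂ) (n d : ℕ) : ℂ := d.choose n * c d / 2 ^ d

section

variable {c : ℕ → ℂ} {δ : ℝ} {n d : ℕ}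

theorem halfBinomialTerm_succ_mul (hd : n ≤ d) (hcd : c d ≠ 0) :
    halfBinomialTerm c n (d + 1) * (2 * ((d + 1 : ℝ) - n) : ℝ) =
      ((d + 1 : ℝ) : ℂ) * (c (d + 1) / c d) * halfBinomialTerm c n d := by
  have h : (d.choose n : ℂ) * (d + 1) = (d + 1).choose n * ((d + 1) - n) := by
    have := Nat.choose_mul_succ_eq d n
    have h2 : ((d + 1 - n : ℕ) : ℂ) = (d + 1) - n := by
      rw [Nat.cast_sub (by lia)]; push_cast; ring
    rw [← h2]; exact_mod_cast this
  unfold halfBinomialTerm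
  push_cast
  field_simp
  linear_combination (-2 * 2 ^ d * c (d + 1)) * h

theorem norm_halfBinomialTerm_succ_mul (hd : n ≤ d) (hcd : c d ≠ 0) :
    ‖halfBinomialTerm c n (d + 1)‖ * (2 * ((d + 1 : ℝ) - n)) =
      (d + 1 : ℝ) * ‖c (d + 1) / c d‖ * ‖halfBinomialTerm c n d‖ := by
  have h := congrArg norm (halfBinomialTerm_succ_mul hd hcd)
  have hd' : (n : ℝ) ≤ d := by exact_mod_cast hd
  rwa [norm_mul, norm_mul, norm_mul, Complex.norm_real, Complex.norm_real,
    Real.norm_of_nonneg (by linarith), Real.norm_of_nonneg (by positivity)] at h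

theorem norm_halfBinomialTerm_succ_le (hδ : 0 < δ) (hδ' : δ ≤ 1 / 64) (hn : 0 < n) (hd : n ≤ d)
    (hcd : c d ≠ 0)
    (hs : ‖c (d + 1) / c d - 1‖ ≤ δ) (hy : (2 + 8 * δ) * n ≤ (d + 1 : ℝ)) :
    ‖halfBinomialTerm c n (d + 1)‖ ≤ (1 - δ) * ‖halfBinomialTerm c n d‖ := by
  have h := norm_halfBinomialTerm_succ_mul hd hcd
  have hn' : (0 : ℝ) < n := by exact_mod_cast hn
  have hs1 : ‖c (d + 1) / c d‖ ≤ 1 + δ := by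
    have := norm_sub_norm_le (c (d + 1) / c d) 1
    rw [norm_one] at this; linarith
  have hpos : 0 < 2 * ((d + 1 : ℝ) - n) := by nlinarith
  refine le_of_mul_le_mul_right ?_ hpos
  rw [h, mul_right_comm (1 - δ)]
  refine mul_le_mul_of_nonneg_right ?_ (norm_nonneg _)
  have h1 : (d + 1 : ℝ) * ‖c (d + 1) / c d‖ ≤ (d + 1 : ℝ) * (1 + δ) := by gcongr
  have h2 : (1 - 3 * δ) * ((2 + 8 * δ) * n) ≤ (1 - 3 * δ) * (d + 1 : ℝ) :=
    mul_le_mul_of_nonneg_left hy (by linarith)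
  have h3 : 0 ≤ n * (δ * (1 - 6 * δ)) := by
    have : 0 ≤ 1 - 6 * δ := by linarith
    positivity
  nlinarith

theorem norm_halfBinomialTerm_le_succ (hδ : 0 < δ) (hδ' : δ ≤ 1 / 64) (hd : n ≤ d)
    (hcd : c d ≠ 0)
    (hs : ‖c (d + 1) / c d - 1‖ ≤ δ) (hy : (d + 1 : ℝ) ≤ (2 - 8 * δ) * n) :
    ‖halfBinomialTerm c n d‖ ≤ (1 - δ) * ‖halfBinomialTerm c n (d + 1)‖ := by
  have h := norm_halfBinomialTerm_succ_mul hd hcd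
  have hs1 : 1 - δ ≤ ‖c (d + 1) / c d‖ := by
    have := norm_sub_norm_le (1 : ℂ) (c (d + 1) / c d)
    rw [norm_one, norm_sub_rev] at this; linarith
  have hpos : 0 < (d + 1 : ℝ) * (1 - δ) := mul_pos (by positivity) (by linarith)
  refine le_of_mul_le_mul_left ?_ hpos
  have h1 : (d + 1 : ℝ) * (1 - δ) * ‖halfBinomialTerm c n d‖ ≤
      ‖halfBinomialTerm c n (d + 1)‖ * (2 * ((d + 1 : ℝ) - n)) := by rw [h]; gcongr
  refine h1.trans ?_
  rw [mul_comm, ← mul_assoc]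
  refine mul_le_mul_of_nonneg_right ?_ (norm_nonneg _)
  have h2 : (1 + 2 * δ) * (d + 1 : ℝ) ≤ (1 + 2 * δ) * ((2 - 8 * δ) * n) :=
    mul_le_mul_of_nonneg_left hy (by linarith)
  have h3 : 0 ≤ n * δ := by positivity
  have h4 : 0 ≤ δ ^ 2 * (d + 1 : ℝ) := by positivity
  have h5 : 0 ≤ δ ^ 2 * n := by positivity
  nlinarith

theorem norm_halfBinomialTerm_succ_sub_le (hδ : 0 < δ) (hδ' : δ ≤ 1 / 64) (hn : 0 < n)
    (hd : n ≤ d) (hcd : c d ≠ 0)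
    (hs : ‖c (d + 1) / c d - 1‖ ≤ δ) (hy : |(d + 1 : ℝ) - 2 * n| ≤ 16 * δ * n) :
    ‖halfBinomialTerm c n (d + 1) - halfBinomialTerm c n d‖ ≤
      64 * δ * ‖halfBinomialTerm c n d‖ := by
  have hn' : (0 : ℝ) < n := by exact_mod_cast hn
  obtain ⟨hy1, hy2⟩ := abs_le.1 hy
  have hδn : δ * n ≤ 1 / 64 * n := by gcongr
  have hpos : (n : ℝ) ≤ 2 * ((d + 1 : ℝ) - n) := by nlinarith
  have hpos' : 0 < 2 * ((d + 1 : ℝ) - n) := hn'.trans_le hpos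
  have h := halfBinomialTerm_succ_mul hd hcd
  have heq : (halfBinomialTerm c n (d + 1) - halfBinomialTerm c n d) *
      (2 * ((d + 1 : ℝ) - n) : ℝ) = (((d + 1 : ℝ) : ℂ) * (c (d + 1) / c d - 1) -
        ((d + 1 : ℝ) - 2 * n : ℝ)) * halfBinomialTerm c n d := by
    rw [sub_mul, h]; push_cast; ring
  have hb : ‖((d + 1 : ℝ) : ℂ) * (c (d + 1) / c d - 1) - ((d + 1 : ℝ) - 2 * n : ℝ)‖ ≤
      64 * δ * n := by
    refine (norm_sub_le _ _).trans ?_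
    rw [norm_mul, Complex.norm_real, Complex.norm_real, Real.norm_of_nonneg (by positivity),
      Real.norm_eq_abs]
    have : (d + 1 : ℝ) * ‖c (d + 1) / c d - 1‖ ≤ (3 * n) * δ := by
      gcongr
      linarith
    nlinarith
  refine le_of_mul_le_mul_right ?_ hpos'
  have := congrArg norm heq
  rw [norm_mul, norm_mul, Complex.norm_real, Real.norm_of_nonneg hpos'.le] at this
  rw [this, mul_right_comm]
  gcongr
  exact hb.trans (by gcongr)

/-- Each consecutive difference of the binomially weighted coefficients is small compared with some
nearby weighted coefficient. -/
theorem exists_forall_eventually_halfBinomialTerm (hc : ∀ᶠ d in atTop, c d ≠ 0)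
    (hr : Tendsto (fun d => c (d + 1) / c d) atTop (nhds 1)) {ε : ℝ} (hε : 0 < ε) (hε1 : ε ≤ 1) :
    ∃ K : ℕ, ∀ᶠ n in atTop, Summable (fun d => ‖halfBinomialTerm c n d‖) ∧ ∀ d,
      ‖halfBinomialTerm c n (d + 1) - halfBinomialTerm c n d‖ ≤ ε * ‖halfBinomialTerm c n d‖ ∨
      ‖halfBinomialTerm c n (d + 1) - halfBinomialTerm c n d‖ ≤
        ε * ‖halfBinomialTerm c n (d + 1 + K)‖ ∨
      K ≤ d ∧ ‖halfBinomialTerm c n (d + 1) - halfBinomialTerm c n d‖ ≤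
        ε * ‖halfBinomialTerm c n (d - K)‖ := by
  obtain ⟨δ, rfl⟩ : ∃ δ, ε = 64 * δ := ⟨ε / 64, by ring⟩
  have hδ : 0 < δ := by linarith
  have hδ' : δ ≤ 1 / 64 := by linarith
  have hρ0 : 0 ≤ 1 - δ := by linarith
  obtain ⟨K, hK⟩ := exists_pow_lt_of_lt_one (by linarith : 0 < 32 * δ) (by linarith : 1 - δ < 1)
  refine ⟨K, ?_⟩
  have hs : ∀ᶠ d in atTop, ‖c (d + 1) / c d - 1‖ ≤ δ := by
    filter_upwards [hr.eventually (Metric.closedBall_mem_nhds 1 hδ)] with d hd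
    rwa [← dist_eq_norm]
  obtain ⟨N, hN⟩ := eventually_atTop.1 (hc.and hs)
  have hnK : ∀ᶠ n : ℕ in atTop, (K : ℝ) / (8 * δ) ≤ n :=
    tendsto_natCast_atTop_atTop.eventually_ge_atTop _
  filter_upwards [eventually_ge_atTop N, eventually_gt_atTop 0, hnK] with n hnN hn hnK
  have hn' : (0 : ℝ) < n := by exact_mod_cast hn
  rw [div_le_iff₀ (by positivity)] at hnK
  have hδn : δ * n ≤ 1 / 64 * n := by gcongr
  set u := halfBinomialTerm c n with hu
  have hright (d : ℕ) (hy : (2 + 8 * δ) * n ≤ (d + 1 : ℝ)) : ‖u (d + 1)‖ ≤ (1 - δ) * ‖u d‖ := by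
    have hnd : n ≤ d := by
      have : (n : ℝ) < d + 1 := by nlinarith
      exact Nat.lt_succ_iff.1 (by exact_mod_cast this)
    have := hN d (hnN.trans hnd)
    exact norm_halfBinomialTerm_succ_le hδ hδ' hn hnd this.1 this.2 hy
  have hleft (d : ℕ) (hy : (d + 1 : ℝ) ≤ (2 - 8 * δ) * n) : ‖u d‖ ≤ (1 - δ) * ‖u (d + 1)‖ := by
    rcases lt_or_ge d n with hnd | hnd
    · have : u d = 0 := by simp [hu, halfBinomialTerm, Nat.choose_eq_zero_of_lt hnd]
      rw [this, norm_zero]; positivity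
    · have := hN d (hnN.trans hnd)
      exact norm_halfBinomialTerm_le_succ hδ hδ' hnd this.1 this.2 hy
  refine ⟨?_, fun d => ?_⟩
  · refine summable_of_ratio_norm_eventually_le (r := 1 - δ) (by linarith) ?_
    filter_upwards [tendsto_natCast_atTop_atTop.eventually_ge_atTop ((2 + 8 * δ) * (n : ℝ))]
      with d hd
    rw [norm_norm, norm_norm]
    exact hright d (by linarith)
  rcases le_or_gt (d + 1 : ℝ) ((2 - 16 * δ) * n) with hy | hy
  · right; left
    have hj (j : ℕ) (hjK : j ≤ K) : ‖u (d + 1)‖ ≤ (1 - δ) ^ j * ‖u (d + 1 + j)‖ := by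
      induction j with
      | zero => simp
      | succ j ih =>
        refine (ih (by lia)).trans ?_
        rw [pow_succ, mul_assoc]
        gcongr
        refine hleft _ ?_
        have : (j + 1 : ℝ) ≤ K := by exact_mod_cast hjK
        push_cast
        nlinarith
    have h1 := hleft d (by nlinarith)
    have h2 := hj K le_rfl
    have h3 : (1 - δ) ^ K * ‖u (d + 1 + K)‖ ≤ 32 * δ * ‖u (d + 1 + K)‖ := by gcongr
    have h4 : (1 - δ) * ‖u (d + 1)‖ ≤ 1 * ‖u (d + 1)‖ := by gcongr; linarith
    have := norm_sub_le (u (d + 1)) (u d)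
    linarith
  rcases le_or_gt ((2 + 16 * δ) * n) (d + 1 : ℝ) with hy2 | hy2
  · right; right
    have hKd : K ≤ d := by
      have : (K : ℝ) < d + 1 := by nlinarith
      exact Nat.lt_succ_iff.1 (by exact_mod_cast this)
    refine ⟨hKd, ?_⟩
    obtain ⟨e, rfl⟩ := Nat.exists_eq_add_of_le' hKd
    rw [Nat.add_sub_cancel]
    push_cast at hy2
    have hj (j : ℕ) : ‖u (e + j)‖ ≤ (1 - δ) ^ j * ‖u e‖ := by
      induction j with
      | zero => simp
      | succ j ih =>
        rw [pow_succ', mul_assoc]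
        have : (2 + 8 * δ) * n ≤ ((e + j : ℕ) + 1 : ℝ) := by
          push_cast
          nlinarith
        exact (hright (e + j) this).trans (mul_le_mul_of_nonneg_left ih hρ0)
    have h1 := hright (e + K) (by push_cast; nlinarith)
    have h2 := hj K
    have h3 : (1 - δ) ^ K * ‖u e‖ ≤ 32 * δ * ‖u e‖ := by gcongr
    have h4 : (1 - δ) * ‖u (e + K)‖ ≤ 1 * ‖u (e + K)‖ := by gcongr; linarith
    have := norm_sub_le (u (e + K + 1)) (u (e + K))
    linarith
  · left
    have hnd : n ≤ d := by
      have : (n : ℝ) < d + 1 := by nlinarith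
      exact Nat.lt_succ_iff.1 (by exact_mod_cast this)
    have := hN d (hnN.trans hnd)
    exact norm_halfBinomialTerm_succ_sub_le hδ hδ' hn hnd this.1 this.2
      (abs_le.2 ⟨by linarith, by linarith⟩)

end

theorem tsum_halfBinomialTerm_mul_pow {c : ℕ → ℂ} (hc : ∀ᶠ d in atTop, c d ≠ 0)
    (hr : Tendsto (fun d => c (d + 1) / c d) atTop (nhds 1)) {g : ℂ → ℂ}
    (hg : ∀ t ∈ Metric.ball (0 : ℂ) 1, g t = ∑' d, c d * t ^ d) {n : ℕ} {t : ℂ} (ht : ‖t‖ = 1)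
    (hs : Summable fun d => ‖halfBinomialTerm c n d‖) :
    ∑' d, halfBinomialTerm c n d * t ^ d =
      (t / 2) ^ n * (iteratedDeriv n g (t / 2) / n.factorial) := by
  have ht2 : t / 2 ∈ Metric.ball (0 : ℂ) 1 := by
    rw [mem_ball_zero_iff, norm_div, ht]; norm_num
  have hs' : Summable fun d => halfBinomialTerm c n d * t ^ d := .of_norm (by simpa [ht] using hs)
  have hn : (n.factorial : ℂ) ≠ 0 := Nat.cast_ne_zero.2 n.factorial_ne_zero
  rw [iteratedDeriv_eq_tsum_of_ratio n hc hr hg ht2, ← hs'.sum_add_tsum_nat_add n,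
    Finset.sum_eq_zero, zero_add, ← tsum_div_const, ← tsum_mul_left]
  · refine tsum_congr fun d => ?_
    unfold halfBinomialTerm
    rw [div_pow, div_pow, pow_add, pow_add]
    field_simp
  · intro d hd
    simp [halfBinomialTerm, Nat.choose_eq_zero_of_lt (Finset.mem_range.1 hd)]

theorem norm_le_mul_norm_halfBinomialTerm (c : ℕ → ℂ) {n : ℕ} (hn : 0 < n) :
    ‖c (2 * n)‖ ≤ 2 * n * ‖halfBinomialTerm c n (2 * n)‖ := by
  have h : (4 : ℝ) ^ n ≤ 2 * n * n.centralBinom := by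
    exact_mod_cast Nat.four_pow_le_two_mul_self_mul_centralBinom n hn
  have h4 : (0 : ℝ) < 4 ^ n := by positivity
  have h2 : ‖halfBinomialTerm c n (2 * n)‖ = n.centralBinom * ‖c (2 * n)‖ / 4 ^ n := by
    simp only [halfBinomialTerm, ← Nat.centralBinom_eq_two_mul_choose, norm_div, norm_mul,
      norm_pow, Complex.norm_natCast, pow_mul, Complex.norm_ofNat]
    norm_num
  rw [h2, ← mul_div_assoc, le_div_iff₀ h4]
  nlinarith [mul_le_mul_of_nonneg_right h (norm_nonneg (c (2 * n)))]

theorem not_eventually_norm_even_le_of_ratio {c : ℕ → ℂ} (hc : ∀ᶠ d in atTop, c d ≠ 0)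
    (hr : Tendsto (fun d => c (d + 1) / c d) atTop (nhds 1)) {l : ℝ} (hl0 : 0 < l) (hl1 : l < 1)
    (M : ℝ) : ¬ ∀ᶠ n : ℕ in atTop, ‖c (2 * n)‖ ≤ M * (n * l ^ n) := by
  intro h
  have hb : Tendsto (fun d => (c (d + 1))⁻¹ / (c d)⁻¹) atTop (nhds 1) := by
    have := hr.inv₀ one_ne_zero
    rw [inv_one] at this
    exact this.congr fun d => by rw [inv_div, div_inv_eq_mul, div_eq_mul_inv, mul_comm]
  have hb0 : ∀ᶠ d : ℕ in atTop, ((d : ℂ) + 1) * (c (d + 1))⁻¹ ≠ 0 := by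
    filter_upwards [(tendsto_add_atTop_nat 1).eventually hc] with d hd
    exact mul_ne_zero (Nat.cast_add_one_ne_zero d) (inv_ne_zero hd)
  have hμ0 : 0 < √l := Real.sqrt_pos.2 hl0
  have hμ1 : √l < 1 := by rw [Real.sqrt_lt' one_pos]; simpa using hl1
  have hs := (summable_norm_mul_pow_of_ratio (c := fun d : ℕ => ((d : ℂ) + 1) * (c (d + 1))⁻¹) hb0
    (tendsto_ratio_derivative_coeff (c := fun d => (c d)⁻¹) hb) hμ0 hμ1).tendsto_atTop_zero
  have ht : Tendsto (fun n : ℕ => 2 * n + 1) atTop atTop :=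
    tendsto_atTop_mono (fun n => by lia : ∀ n, n ≤ 2 * n + 1) tendsto_id
  have hlim := (hs.comp ht).const_mul (M * √l / 2)
  rw [mul_zero] at hlim
  have hev := (tendsto_add_atTop_nat 1).eventually
    (h.and ((tendsto_id.const_mul_atTop' two_pos).eventually hc))
  have hone : ∀ᶠ n : ℕ in atTop, 1 ≤ M * √l / 2 *
      ((fun d : ℕ => ‖((d : ℂ) + 1) * (c (d + 1))⁻¹‖ * √l ^ d) ∘ fun n => 2 * n + 1) n := by
    filter_upwards [hev] with n ⟨h1, h2⟩
    have h2' : 0 < ‖c (2 * (n + 1))‖ := norm_pos_iff.2 h2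
    have hcast : ‖((2 * n + 1 : ℕ) : ℂ) + 1‖ = 2 * (n + 1) := by
      have : ((2 * n + 1 : ℕ) : ℂ) + 1 = ((2 * (n + 1) : ℕ) : ℂ) := by push_cast; ring
      rw [this, Complex.norm_natCast]; push_cast; ring
    have hpow : √l * √l ^ (2 * n + 1) = l ^ (n + 1) := by
      rw [← pow_succ', show 2 * n + 1 + 1 = 2 * (n + 1) by ring, pow_mul, Real.sq_sqrt hl0.le]
    simp only [Function.comp]
    rw [norm_mul, hcast, norm_inv, show 2 * n + 1 + 1 = 2 * (n + 1) by ring]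
    calc 1 ≤ M * (((n + 1 : ℕ) : ℝ) * l ^ (n + 1)) / ‖c (2 * (n + 1))‖ := (one_le_div h2').2 h1
      _ = _ := by rw [← hpow]; push_cast; field_simp
  exact absurd (ge_of_tendsto hlim hone) (by norm_num)

theorem false_of_analyticAt_one_of_ratio {c : ℕ → ℂ} (hc : ∀ᶠ d in atTop, c d ≠ 0)
    (hr : Tendsto (fun d => c (d + 1) / c d) atTop (nhds 1)) {U : Set ℂ} (hU : IsOpen U)
    (h1U : 1 ∈ U) {g : ℂ → ℂ} (hga : ∀ w ∈ Metric.ball (0 : ℂ) 1 ∪ U, AnalyticAt ℂ g w)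
    (hg : ∀ t ∈ Metric.ball (0 : ℂ) 1, g t = ∑' d, c d * t ^ d) : False := by
  have hsub : Metric.closedBall (1 / 2 : ℂ) (1 / 2) ⊆ Metric.ball 0 1 ∪ U := by
    intro w hw
    rw [mem_closedBall_iff_norm] at hw
    by_cases hw1 : w = 1
    · exact .inr (hw1 ▸ h1U)
    left
    rw [mem_ball_zero_iff]
    have hsq : ‖w - 1 / 2‖ ^ 2 ≤ (1 / 2) ^ 2 := by gcongr
    rw [← Complex.normSq_eq_norm_sq, Complex.normSq_apply] at hsq
    rw [← abs_of_nonneg (norm_nonneg w), ← sq_lt_one_iff_abs_lt_one, ← Complex.normSq_eq_norm_sq,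
      Complex.normSq_apply]
    norm_num at hsq
    have hre : w.re < 1 := by
      by_contra! hre
      have h1 : w.re = 1 := by nlinarith [mul_self_nonneg w.im]
      have h2 : w.im = 0 := by
        rw [h1] at hsq
        nlinarith [mul_self_nonneg w.im]
      exact hw1 (Complex.ext h1 h2)
    nlinarith
  obtain ⟨δ, hδ, hthick⟩ := (isCompact_closedBall (1 / 2 : ℂ) (1 / 2)).exists_thickening_subset_open
    (Metric.isOpen_ball.union hU) hsub
  rw [thickening_closedBall hδ (by norm_num)] at hthick
  obtain ⟨m, hm, hm1, hmδ⟩ : ∃ m : ℝ, 0 < m ∧ m ≤ 1 ∧ m ≤ δ :=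
    ⟨min 1 δ, by positivity, min_le_left _ _, min_le_right _ _⟩
  have hbig : Metric.closedBall (1 / 2 : ℂ) (1 / 2 + 3 * m / 4) ⊆ Metric.ball 0 1 ∪ U :=
    (Metric.closedBall_subset_ball (by linarith)).trans hthick
  have hdiff : DifferentiableOn ℂ g (Metric.closedBall (1 / 2 : ℂ) (1 / 2 + 3 * m / 4)) :=
    fun w hw => (hga w (hbig hw)).differentiableAt.differentiableWithinAt
  obtain ⟨M, hM⟩ := (isCompact_closedBall _ _).exists_bound_of_continuousOn hdiff.continuousOn
  have hM0 : 0 ≤ M := (norm_nonneg _).trans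
    (hM (1 / 2) (Metric.mem_closedBall_self (by positivity)))
  set R := 1 / 2 + m / 4 with hR
  have hR0 : 0 < R := by positivity
  set l := 1 / (2 * R) with hl
  have hl0 : 0 < l := by positivity
  have hl1 : l < 1 := by
    rw [hl, div_lt_one (by positivity)]; linarith
  obtain ⟨K, hK⟩ := exists_forall_eventually_halfBinomialTerm hc hr (ε := m / 3) (by positivity)
    (by linarith)
  refine not_eventually_norm_even_le_of_ratio hc hr hl0 hl1 (4 * M) ?_
  filter_upwards [hK, eventually_gt_atTop 0] with n ⟨hs, hd⟩ hn
  have hu0 : halfBinomialTerm c n 0 = 0 := by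
    simp [halfBinomialTerm, Nat.choose_eq_zero_of_lt hn]
  have hs2 : Summable fun d => ‖halfBinomialTerm c n d‖ ^ 2 :=
    (hasSum_sq_norm_integral_fourier hs).summable
  have hupper := tsum_sq_norm_diff_le hs2 hd
  have hlower := sq_mul_tsum_sub_le_tsum_sq_norm_diff hs hu0 (E := (M * l ^ n) ^ 2) hm.le ?_
    (sq_nonneg _)
  · have hS := hs2.le_tsum (2 * n) fun _ _ => sq_nonneg _
    set S := ∑' d, ‖halfBinomialTerm c n d‖ ^ 2
    have hS2 : m ^ 2 * (S - (M * l ^ n) ^ 2) ≤ m ^ 2 * (S / 3) := by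
      refine hlower.trans (hupper.trans_eq ?_); ring
    have hS3 := le_of_mul_le_mul_left hS2 (by positivity)
    have hu : ‖halfBinomialTerm c n (2 * n)‖ ≤ 2 * (M * l ^ n) := by
      refine (pow_le_pow_iff_left₀ (norm_nonneg _) (by positivity) two_ne_zero).1 ?_
      nlinarith [sq_nonneg (M * l ^ n)]
    calc ‖c (2 * n)‖ ≤ 2 * n * ‖halfBinomialTerm c n (2 * n)‖ :=
          norm_le_mul_norm_halfBinomialTerm c hn
      _ ≤ 2 * n * (2 * (M * l ^ n)) := by gcongr
      _ = _ := by ring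
  · intro t ht htm
    rw [tsum_halfBinomialTerm_mul_pow hc hr hg ht hs]
    have hball : Metric.closedBall (t / 2) R ⊆ Metric.closedBall (1 / 2) (1 / 2 + 3 * m / 4) := by
      refine Metric.closedBall_subset_closedBall' ?_
      have : dist (t / 2) (1 / 2) = ‖1 - t‖ / 2 := by
        rw [dist_comm, dist_eq_norm, ← sub_div, norm_div]; norm_num
      rw [this]; linarith
    have hcauchy := Complex.norm_iteratedDeriv_le_of_forall_mem_sphere_norm_le n hR0
      (hdiff.diffContOnCl_ball hball) fun w hw => hM w (hball (Metric.sphere_subset_closedBall hw))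
    have hf : (0 : ℝ) < n.factorial := by exact_mod_cast n.factorial_pos
    gcongr
    rw [norm_mul, norm_pow, norm_div, norm_div, ht, Complex.norm_natCast, Complex.norm_ofNat]
    calc (1 / 2 : ℝ) ^ n * (‖iteratedDeriv n g (t / 2)‖ / n.factorial)
        ≤ (1 / 2 : ℝ) ^ n * (n.factorial * M / R ^ n / n.factorial) := by gcongr
      _ = M * l ^ n := by
        rw [hl, div_pow, div_pow, mul_pow]; field_simp

/-- Singularity part of the ratio theorem of Fabry: if `c d / c (d+1) → z ≠ 0`
(with `c d ≠ 0` eventually), then `z` is a singular point of the series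
`f t = ∑ c_d t^d` on the disk `B(0,‖z‖)`: there is no open neighborhood `U` of `z`
and function `g` analytic at every point of `B(0,‖z‖) ∪ U` agreeing with `f` on the disk. -/
theorem fabry_singular_point (c : ℕ → ℂ) (z : ℂ)
    (hc : ∀ᶠ d in atTop, c d ≠ 0) (hz : z ≠ 0)
    (hlim : Tendsto (fun d => c d / c (d + 1)) atTop (nhds z)) :
    ¬ ∃ U : Set ℂ, IsOpen U ∧ z ∈ U ∧ ∃ g : ℂ → ℂ,
        (∀ w ∈ Metric.ball (0 : ℂ) ‖z‖ ∪ U, AnalyticAt ℂ g w) ∧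
        (∀ t ∈ Metric.ball (0 : ℂ) ‖z‖, g t = ∑' d : ℕ, c d * t ^ d) := by
  rintro ⟨U, hU, hzU, g, hga, hg⟩
  have hball {t : ℂ} (ht : t ∈ Metric.ball (0 : ℂ) 1) : z * t ∈ Metric.ball (0 : ℂ) ‖z‖ := by
    rw [mem_ball_zero_iff] at ht ⊢
    rw [norm_mul]
    exact mul_lt_of_lt_one_right (norm_pos_iff.2 hz) ht
  refine false_of_analyticAt_one_of_ratio (c := fun d => c d * z ^ d)
    (U := (fun t => z * t) ⁻¹' U) (g := fun t => g (z * t))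
    (hc.mono fun d hd => mul_ne_zero hd (pow_ne_zero d hz)) ?_
    (hU.preimage (by fun_prop)) (by simpa using hzU) ?_ ?_
  · have h := (hlim.inv₀ hz).mul_const z
    rw [inv_mul_cancel₀ hz] at h
    refine h.congr fun d => ?_
    have := pow_ne_zero d hz
    rw [inv_div, pow_succ]
    field_simp
  · intro w hw
    have : AnalyticAt ℂ g (z * w) := hga _ (hw.imp (fun h => hball h) id)
    exact this.comp (f := fun t => z * t) (by fun_prop)
  · intro t ht
    rw [hg _ (hball ht)]
    exact tsum_congr fun d => by ring
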